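/- Let l ≥ 2, let β ∈ V_1 ⊖ S_1 and γ ∈ V_l ⊖ S_l be nonzero, and let X_β and X_γ be the closed linear spans in ℓ²(W) of {β_{m,n} : m, n ≥ 0} and {γ_{m,n} : m, n ≥ 0} respectively. Then X_β equals the closed linear span of {h_m(h_n^r β) : m, n ≥ 0} and X_γ equals the closed linear span of {h_m(h_n^r γ) : m, n ≥ 0}; moreover the bounded invertible linear map T : X_β → X_γ determined by T(β_{m,n}) = γ_{m,n} + γ_{m−1,n−1} (with γ_{m−1,n−1} = 0 if m = 0 or n = 0) satisfies T(h_m(h_n^r β)) = h_m(h_n^r γ) for all m, n ≥ 0. -/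

import Mathlib

noncomputable section

open scoped ComplexInnerProductSpace

namespace UCoxMasa

/-- The universal Coxeter matrix on `Fin L`: all off-diagonal entries are `0` (representing ∞). -/
def Mat (L : ℕ) : CoxeterMatrix (Fin L) where
  M := fun i j => if i = j then 1 else 0
  isSymm := by
    ext i j
    by_cases h : i = j <;> simp [Matrix.transpose, h, eq_comm]
  diagonal := fun i => by simp
  off_diagonal := fun i j h => by simp [h]

/-- The universal Coxeter group on `L` generators: free product of `L` copies of `ℤ/2ℤ`. -/
abbrev W (L : ℕ) : Type := (Mat L).Group

/-- The distinguished Coxeter system of `W L`. -/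
def cs (L : ℕ) : CoxeterSystem (Mat L) (W L) := CoxeterMatrix.toCoxeterSystem (Mat L)

/-- The simple reflection associated to `i : Fin L`. -/
def σ {L : ℕ} (i : Fin L) : W L := (cs L).simple i

/-- Word length on `W L` with respect to the generating set of simple reflections. -/
def len {L : ℕ} (w : W L) : ℕ := (cs L).length w

/-- The Hilbert space `ℓ²(W)`. -/
abbrev H (L : ℕ) : Type := lp (fun _ : W L => ℂ) 2

/-- The standard orthonormal basis vector `δ_w` of `ℓ²(W)`. -/
def δ {L : ℕ} (w : W L) : H L :=
  letI := Classical.decEq (W L)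
  lp.single 2 w 1

/-- `V l`: the linear span of `{δ_w : ℓ(w) = l}`. -/
def V (L : ℕ) (l : ℕ) : Submodule ℂ (H L) :=
  Submodule.span ℂ {x : H L | ∃ w : W L, len w = l ∧ x = δ w}

/-- `S_l`: the linear span of `q_l(h V_{l-1}) ∪ q_l(R_h V_{l-1})`,
given the projections `Q`, the operator `h` and the right operator `Rh`. -/
def Sl (L : ℕ) (Q : ℕ → (H L →L[ℂ] H L)) (h Rh : H L →L[ℂ] H L) (l : ℕ) :
    Submodule ℂ (H L) :=
  Submodule.span ℂ
    ({x : H L | ∃ y ∈ V L (l - 1), x = Q l (h y)} ∪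
      {x : H L | ∃ y ∈ V L (l - 1), x = Q l (Rh y)})

end UCoxMasa


namespace UCoxMasa

/-! ### Normal forms and uniqueness of descents -/

/-- Left multiplication by a generator on the level of reduced words. -/
def toggle {L : ℕ} (i : Fin L) : List (Fin L) → List (Fin L)
  | [] => [i]
  | j :: t => if j = i then t else i :: j :: t

lemma isChain_toggle {L : ℕ} (i : Fin L) {l : List (Fin L)} (hl : l.IsChain (· ≠ ·)) :
    (toggle i l).IsChain (· ≠ ·) := by
  cases l with
  | nil => simp [toggle]
  | cons j t =>
    by_cases hji : j = i
    · simpa [toggle, hji] using hl.tail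
    · simpa [toggle, hji] using ⟨Ne.symm hji, hl⟩

lemma toggle_toggle {L : ℕ} (i : Fin L) {l : List (Fin L)} (hl : l.IsChain (· ≠ ·)) :
    toggle i (toggle i l) = l := by
  cases l with
  | nil => simp [toggle]
  | cons j t =>
    by_cases hji : j = i
    · subst hji
      cases t with
      | nil => simp [toggle]
      | cons k t =>
        have : k ≠ j := fun hk => by simp [hk] at hl
        simp [toggle, this]
    · simp [toggle, hji]

/-- The involution of the set of reduced words given by `toggle`. -/
def toggleEnd {L : ℕ} (i : Fin L) : Function.End {l : List (Fin L) // l.IsChain (· ≠ ·)} :=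
  fun l => ⟨toggle i l.1, isChain_toggle i l.2⟩

lemma isLiftable_toggleEnd (L : ℕ) : (Mat L).IsLiftable (toggleEnd (L := L)) := by
  intro i j
  by_cases hij : i = j
  · subst hij
    rw [CoxeterMatrix.diagonal, pow_one]
    funext l
    exact Subtype.ext (toggle_toggle i l.2)
  · have : (Mat L).M i j = 0 := by simp [Mat, hij]
    rw [this, pow_zero]

/-- The action of `W L` on reduced words. -/
def wordAction (L : ℕ) : W L →* Function.End {l : List (Fin L) // l.IsChain (· ≠ ·)} :=
  (cs L).lift ⟨toggleEnd, isLiftable_toggleEnd L⟩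

/-- The reduced word of an element of `W L`. -/
def normalForm {L : ℕ} (w : W L) : List (Fin L) := (wordAction L w ⟨[], by simp⟩).1

lemma normalForm_one {L : ℕ} : normalForm (1 : W L) = [] := by
  simp only [normalForm, map_one]
  rfl

lemma normalForm_simple_mul {L : ℕ} (i : Fin L) (w : W L) :
    normalForm (σ i * w) = toggle i (normalForm w) := by
  have h : wordAction L (σ i) = toggleEnd i :=
    CoxeterSystem.lift_apply_simple (cs L) (isLiftable_toggleEnd L) i
  rw [normalForm, map_mul, h]
  rfl

lemma simple_mul_simple_mul {L : ℕ} (i : Fin L) (w : W L) : σ i * (σ i * w) = w := by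
  simp [σ]

lemma wordProd_toggle {L : ℕ} (i : Fin L) (l : List (Fin L)) :
    (cs L).wordProd (toggle i l) = σ i * (cs L).wordProd l := by
  cases l with
  | nil => simp [toggle, σ]
  | cons j t =>
    by_cases hji : j = i
    · simp [toggle, hji, CoxeterSystem.wordProd_cons, σ]
    · simp [toggle, hji, CoxeterSystem.wordProd_cons, σ]

lemma wordProd_normalForm {L : ℕ} (w : W L) : (cs L).wordProd (normalForm w) = w := by
  induction w using (cs L).simple_induction_left with
  | one => simp [normalForm_one]
  | mul_simple_left w i ih =>
    change (cs L).wordProd (normalForm (σ i * w)) = σ i * w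
    rw [normalForm_simple_mul, wordProd_toggle, ih]

lemma length_toggle_le {L : ℕ} (i : Fin L) (l : List (Fin L)) :
    (toggle i l).length ≤ l.length + 1 := by
  cases l with
  | nil => simp [toggle]
  | cons j t =>
    by_cases hji : j = i
    · simp [toggle, hji]; omega
    · simp [toggle, hji]

lemma length_normalForm {L : ℕ} (w : W L) : (normalForm w).length = len w := by
  apply le_antisymm
  · obtain ⟨ω, hω, rfl⟩ := (cs L).exists_isReduced w
    rw [len, hω.eq]
    clear hω
    induction ω with
    | nil => simp [normalForm_one]
    | cons i ω ih =>
      rw [CoxeterSystem.wordProd_cons]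
      change (normalForm (σ i * _)).length ≤ _
      rw [normalForm_simple_mul]
      exact (length_toggle_le _ _).trans (by simpa using ih)
  · conv_lhs => rw [← wordProd_normalForm w]
    exact (cs L).length_wordProd_le _

lemma head_normalForm_of_descent {L : ℕ} {i : Fin L} {w : W L} (hi : len (σ i * w) < len w) :
    (normalForm w).head? = some i := by
  rw [← length_normalForm, ← length_normalForm w, normalForm_simple_mul] at hi
  cases hw : normalForm w with
  | nil => simp [hw, toggle] at hi
  | cons j t =>
    by_cases hji : j = i
    · simp [hji]
    · simp [hw, toggle, hji] at hi

/-- Multiplication by generators on one fixed side, with the combinatorial facts about lengths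
that do not depend on the side. -/
structure IsStep {L : ℕ} (a : Fin L → W L → W L) : Prop where
  invol : ∀ s w, a s (a s w) = w
  len_step : ∀ s w, len (a s w) = len w + 1 ∨ len (a s w) + 1 = len w
  descent : ∀ w, w ≠ 1 → ∃ s, ∀ t, len (a t w) < len w ↔ t = s

lemma len_inv {L : ℕ} (w : W L) : len w⁻¹ = len w := (cs L).length_inv w

lemma len_eq_zero {L : ℕ} {w : W L} : len w = 0 ↔ w = 1 := (cs L).length_eq_zero_iff

lemma σ_inv {L : ℕ} (i : Fin L) : (σ i : W L)⁻¹ = σ i := (cs L).inv_simple i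

lemma isStep_left (L : ℕ) : IsStep fun (s : Fin L) (w : W L) => σ s * w where
  invol := simple_mul_simple_mul
  len_step s w := (cs L).length_simple_mul w s
  descent w hw := by
    obtain ⟨s, hs⟩ := (cs L).exists_leftDescent_of_ne_one hw
    refine ⟨s, fun t => ⟨fun ht => ?_, fun ht => ht ▸ hs⟩⟩
    have h₁ := head_normalForm_of_descent (i := s) hs
    rw [head_normalForm_of_descent ht] at h₁
    exact Option.some.inj h₁

lemma isStep_right (L : ℕ) : IsStep fun (s : Fin L) (w : W L) => w * σ s where
  invol s w := by simp [σ]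
  len_step s w := (cs L).length_mul_simple w s
  descent w hw := by
    obtain ⟨s, hs⟩ := (isStep_left L).descent w⁻¹ (inv_ne_one.mpr hw)
    refine ⟨s, fun t => ?_⟩
    rw [← hs t, ← len_inv (w * σ t), mul_inv_rev, σ_inv, len_inv]

/-! ### Raising and lowering operators on functions -/

section Operators

variable {L : ℕ} {a : Fin L → W L → W L}

/-- The part of `∑ s, f (a s ·)` that raises the length of the support. -/
def up (a : Fin L → W L → W L) : Module.End ℂ (W L → ℂ) where
  toFun f v := ∑ s, if len (a s v) < len v then f (a s v) else 0
  map_add' f g := by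
    funext v
    simp only [Pi.add_apply, ← Finset.sum_add_distrib]
    exact Finset.sum_congr rfl fun s _ => by split_ifs <;> simp
  map_smul' c f := by
    funext v
    simp [Finset.mul_sum]

/-- The part of `∑ s, f (a s ·)` that lowers the length of the support. -/
def down (a : Fin L → W L → W L) : Module.End ℂ (W L → ℂ) where
  toFun f v := ∑ s, if len v < len (a s v) then f (a s v) else 0
  map_add' f g := by
    funext v
    simp only [Pi.add_apply, ← Finset.sum_add_distrib]
    exact Finset.sum_congr rfl fun s _ => by split_ifs <;> simp
  map_smul' c f := by
    funext v
    simp [Finset.mul_sum]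

lemma up_apply (f : W L → ℂ) (v : W L) :
    up a f v = ∑ s, if len (a s v) < len v then f (a s v) else 0 := rfl

lemma down_apply (f : W L → ℂ) (v : W L) :
    down a f v = ∑ s, if len v < len (a s v) then f (a s v) else 0 := rfl

/-- `f` is supported on words of length `k`. -/
def AtLevel (k : ℕ) (f : W L → ℂ) : Prop := ∀ v, len v ≠ k → f v = 0

/-- `f` is supported on words of length at most `k`. -/
def AtMost (k : ℕ) (f : W L → ℂ) : Prop := ∀ v, k < len v → f v = 0

/-- The restriction of `f` to words of length `k`. -/
def sphereRestrict (k : ℕ) (f : W L → ℂ) : W L → ℂ := fun v => if len v = k then f v else 0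

lemma AtLevel.atMost {k : ℕ} {f : W L → ℂ} (hf : AtLevel k f) : AtMost k f :=
  fun v hv => hf v hv.ne'

lemma AtLevel.sphereRestrict_eq {k : ℕ} {f : W L → ℂ} (hf : AtLevel k f) :
    sphereRestrict k f = f := by
  funext v
  by_cases hv : len v = k
  · simp [sphereRestrict, hv]
  · simp [sphereRestrict, hv, hf v hv]

lemma AtLevel.apply_one {k : ℕ} (hk : k ≠ 0) {f : W L → ℂ} (hf : AtLevel k f) : f 1 = 0 :=
  hf 1 (by rw [len_eq_zero.mpr rfl]; exact hk.symm)

lemma IsStep.up_apply_of_descent (ha : IsStep a) (f : W L → ℂ) {v : W L} {s : Fin L}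
    (hs : len (a s v) < len v) : up a f v = f (a s v) := by
  have hv : v ≠ 1 := by
    rintro rfl
    simp [len_eq_zero.mpr (rfl : (1 : W L) = 1)] at hs
  obtain ⟨r, hr⟩ := ha.descent v hv
  obtain rfl := (hr s).mp hs
  simp [up_apply, hr]

lemma up_apply_one (f : W L → ℂ) : up a f 1 = 0 := by
  simp [up_apply, len_eq_zero.mpr (rfl : (1 : W L) = 1)]

lemma IsStep.atLevel_up (ha : IsStep a) {k : ℕ} {f : W L → ℂ} (hf : AtLevel k f) :
    AtLevel (k + 1) (up a f) := by
  intro v hv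
  rw [up_apply]
  refine Finset.sum_eq_zero fun s _ => ?_
  split_ifs with h
  · exact hf _ (by have := ha.len_step s v; omega)
  · rfl

lemma IsStep.atLevel_up_pow (ha : IsStep a) {k : ℕ} {f : W L → ℂ} (hf : AtLevel k f) (n : ℕ) :
    AtLevel (n + k) ((up a ^ n) f) := by
  induction n with
  | zero => simpa using hf
  | succ n ih =>
    rw [pow_succ', Module.End.mul_apply, Nat.add_right_comm]
    exact ha.atLevel_up ih

lemma IsStep.down_up (ha : IsStep a) {f : W L → ℂ} (hf : f 1 = 0) :
    down a (up a f) = ((L : ℂ) - 1) • f := by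
  funext v
  by_cases hv : v = 1
  · subst hv
    have : ∀ s, up a f (a s 1) = 0 := fun s => by
      rw [ha.up_apply_of_descent f (s := s), ha.invol, hf]
      rw [ha.invol, len_eq_zero.mpr rfl]
      have := ha.len_step s 1
      rw [len_eq_zero.mpr rfl] at this
      omega
    simp [down_apply, this, hf]
  · obtain ⟨r, hr⟩ := ha.descent v hv
    have : ∀ s, (if len v < len (a s v) then up a f (a s v) else 0) =
        f v - if s = r then f v else 0 := fun s => by
      have hs := ha.len_step s v
      by_cases h : s = r
      · have := (hr s).mpr h
        rw [if_neg (by omega), if_pos h, sub_self]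
      · have := mt (hr s).mp h
        have h' : len v < len (a s v) := by omega
        rw [if_pos h', if_neg h, ha.up_apply_of_descent f (s := s) (by rwa [ha.invol]), ha.invol,
          sub_zero]
    simp [down_apply, this, Finset.sum_sub_distrib, sub_mul]

/-- Left lowering commutes with right raising at words of length at least two. -/
lemma down_left_up_right_apply (f : W L → ℂ) {v : W L} (hv : 2 ≤ len v) :
    down (fun s w => σ s * w) (up (fun s w => w * σ s) f) v =
      up (fun s w => w * σ s) (down (fun s w => σ s * w) f) v := by
  have hL := isStep_left L
  have hR := isStep_right L
  have hv1 : v ≠ 1 := by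
    rintro rfl
    simp [len_eq_zero.mpr (rfl : (1 : W L) = 1)] at hv
  obtain ⟨r, hr⟩ := hR.descent v hv1
  have hrv : len (v * σ r) < len v := (hr r).mpr rfl
  have hvr : v * σ r ≠ 1 := by
    intro h
    have := hR.len_step r v
    simp only [h, len_eq_zero.mpr (rfl : (1 : W L) = 1)] at this
    omega
  obtain ⟨t, ht⟩ := hL.descent (v * σ r) hvr
  obtain ⟨t', ht'⟩ := hL.descent v hv1
  have htt : t = t' := by
    rw [← ht' t]
    have h₁ := (ht t).mpr rfl
    have h₂ := hR.len_step r (σ t * v)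
    simp only [mul_assoc] at h₁ h₂ hrv ⊢
    have h₃ := hR.len_step r v
    have h₄ := hL.len_step t (v * σ r)
    omega
  subst htt
  rw [hR.up_apply_of_descent _ hrv, down_apply, down_apply]
  refine Finset.sum_congr rfl fun s _ => ?_
  have h₁ := hL.len_step s v
  have h₂ := hL.len_step s (v * σ r)
  have h₃ := hR.len_step r (σ s * v)
  have h₄ := hR.len_step r v
  have h₅ := ht s
  have h₆ := ht' s
  by_cases hs : s = t
  · rw [if_neg (by have := h₆.mpr hs; omega), if_neg (by have := h₅.mpr hs; omega)]
  · have h₇ := mt h₅.mp hs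
    have h₈ := mt h₆.mp hs
    rw [if_pos (by omega), if_pos (by omega), hR.up_apply_of_descent f (s := r), mul_assoc]
    simp only [mul_assoc] at h₃ h₂ h₇ ⊢
    omega

/-- Left lowering after right raising, at a word of length one. -/
lemma down_left_up_right_simple (f : W L → ℂ) (t : Fin L) :
    down (fun s w => σ s * w) (up (fun s w => w * σ s) f) (σ t) = (∑ s, f (σ s)) - f (σ t) := by
  have hL := isStep_left L
  have hR := isStep_right L
  have hone : len (1 : W L) = 0 := len_eq_zero.mpr rfl
  have hsq : ∀ s : Fin L, (σ s : W L) * σ s = 1 := fun s => (cs L).simple_mul_simple_self s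
  have hlen : ∀ s : Fin L, len (σ s : W L) = 1 := fun s => (cs L).length_simple s
  obtain ⟨r, hr⟩ := hL.descent (σ t) (by intro h; simpa [h, hone] using hlen t)
  have htr : t = r := (hr t).mp (by rw [hsq, hone, hlen]; exact one_pos)
  subst htr
  have : ∀ s, (if len (σ t : W L) < len (σ s * σ t) then
      up (fun s w => w * σ s) f (σ s * σ t) else 0) =
      f (σ s) - if s = t then f (σ t) else 0 := fun s => by
    have hs := hL.len_step s (σ t)
    by_cases h : s = t
    · rw [if_neg (by have := (hr s).mpr h; omega), if_pos h, h, sub_self]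
    · have := mt (hr s).mp h
      have h' : len (σ t : W L) < len (σ s * σ t) := by omega
      rw [if_pos h', if_neg h, sub_zero, hR.up_apply_of_descent f (s := t), mul_assoc, hsq, mul_one]
      simp only [mul_assoc, hsq, mul_one]
      rw [hlen] at h' ⊢
      exact h'
  rw [down_apply, Finset.sum_congr rfl fun s _ => this s]
  simp

lemma exists_simple_of_len_eq_one {v : W L} (hv : len v = 1) : ∃ t, v = σ t :=
  (cs L).length_eq_one_iff.mp hv

lemma down_left_one (f : W L → ℂ) : down (fun s w => σ s * w) f 1 = ∑ s, f (σ s) := by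
  have hone : len (1 : W L) = 0 := len_eq_zero.mpr rfl
  have hlen : ∀ s : Fin L, len (σ s : W L) = 1 := fun s => (cs L).length_simple s
  simp [down_apply, hone, hlen]

lemma down_left_up_right_apply_one (f : W L → ℂ) (hf : f 1 = 0) :
    down (fun s w => σ s * w) (up (fun s w => w * σ s) f) 1 = 0 := by
  have hR := isStep_right L
  have hone : len (1 : W L) = 0 := len_eq_zero.mpr rfl
  have hsq : ∀ s : Fin L, (σ s : W L) * σ s = 1 := fun s => (cs L).simple_mul_simple_self s
  have hlen : ∀ s : Fin L, len (σ s : W L) = 1 := fun s => (cs L).length_simple s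
  rw [down_left_one]
  refine Finset.sum_eq_zero fun s _ => ?_
  rw [hR.up_apply_of_descent f (s := s), hsq, hf]
  simp [hsq, hone, hlen]

lemma down_left_up_right {k : ℕ} (hk : 2 ≤ k) {f : W L → ℂ} (hf : AtLevel k f) :
    down (fun s w => σ s * w) (up (fun s w => w * σ s) f) =
      up (fun s w => w * σ s) (down (fun s w => σ s * w) f) := by
  have hR := isStep_right L
  have hone : len (1 : W L) = 0 := len_eq_zero.mpr rfl
  have hsq : ∀ s : Fin L, (σ s : W L) * σ s = 1 := fun s => (cs L).simple_mul_simple_self s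
  have hlen : ∀ s : Fin L, len (σ s : W L) = 1 := fun s => (cs L).length_simple s
  have hσ : ∀ s : Fin L, f (σ s) = 0 := fun s => hf _ (by rw [hlen]; omega)
  funext v
  obtain hv | hv | hv : len v = 0 ∨ len v = 1 ∨ 2 ≤ len v := by omega
  · rw [len_eq_zero.mp hv, down_left_up_right_apply_one f (hf.apply_one (by omega)), up_apply_one]
  · obtain ⟨t, rfl⟩ := exists_simple_of_len_eq_one hv
    rw [down_left_up_right_simple, hR.up_apply_of_descent _ (s := t), hsq, down_left_one]
    · simp [hσ]
    · simp [hsq, hone, hlen]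
  · exact down_left_up_right_apply f hv

lemma down_left_up_right_of_one {f : W L → ℂ} (hf : AtLevel 1 f)
    (hdf : down (fun s w => σ s * w) f = 0) :
    down (fun s w => σ s * w) (up (fun s w => w * σ s) f) = -f := by
  funext v
  obtain hv | hv | hv : len v = 0 ∨ len v = 1 ∨ 2 ≤ len v := by omega
  · rw [len_eq_zero.mp hv, down_left_up_right_apply_one f (hf.apply_one one_ne_zero), Pi.neg_apply,
      hf.apply_one one_ne_zero, neg_zero]
  · obtain ⟨t, rfl⟩ := exists_simple_of_len_eq_one hv
    rw [down_left_up_right_simple, ← down_left_one, hdf]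
    simp
  · rw [down_left_up_right_apply f hv, hdf, map_zero, Pi.neg_apply, hf v (by omega)]
    simp

lemma down_left_up_right_pow {k : ℕ} (hk : 2 ≤ k) {f : W L → ℂ} (hf : AtLevel k f) (n : ℕ) :
    down (fun s w => σ s * w) ((up (fun s w => w * σ s) ^ n) f) =
      (up (fun s w => w * σ s) ^ n) (down (fun s w => σ s * w) f) := by
  induction n with
  | zero => simp
  | succ n ih =>
    rw [pow_succ', Module.End.mul_apply, Module.End.mul_apply, ← ih,
      down_left_up_right (by omega : 2 ≤ n + k) ((isStep_right L).atLevel_up_pow hf n)]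

end Operators

/-! ### Three-term recursions -/

section LinearAlgebra

variable {E : Type*} [AddCommGroup E] [Module ℂ E]

/-- The operators `hn` are obtained from `h` by a three-term recursion. -/
structure ThreeTerm (p : ℂ) (c : ℕ → ℂ) (h : E →ₗ[ℂ] E) (hn : ℕ → E →ₗ[ℂ] E) : Prop where
  zero : ∀ x, hn 0 x = x
  one : ∀ x, hn 1 x = h x
  step : ∀ k x, h (hn (k + 1) x) = hn (k + 2) x + p • hn (k + 1) x + c k • hn k x

/-- The relations between `h`, `Rh` and a double sequence `b`, where `κ` records the failure of
`b 0 n` to be annihilated by the lowering part of `h`. -/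
structure IsArray (p d κ : ℂ) (h Rh : E →ₗ[ℂ] E) (b : ℕ → ℕ → E) : Prop where
  left_zero_zero : h (b 0 0) = b 1 0 + p • b 0 0
  left_zero_succ : ∀ n, h (b 0 (n + 1)) = b 1 (n + 1) + p • b 0 (n + 1) - κ • b 0 n
  left_succ : ∀ m n, h (b (m + 1) n) = b (m + 2) n + p • b (m + 1) n + d • b m n
  right_zero : Rh (b 0 0) = b 0 1 + p • b 0 0
  right_succ : ∀ n, Rh (b 0 (n + 1)) = b 0 (n + 2) + p • b 0 (n + 1) + d • b 0 n

variable {p d κ : ℂ} {c c' : ℕ → ℂ} {h Rh : E →ₗ[ℂ] E} {hn hnr : ℕ → E →ₗ[ℂ] E} {b : ℕ → ℕ → E}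

lemma ThreeTerm.apply_mem (H : ThreeTerm p c h hn) {N : Submodule ℂ E} (hN : ∀ x ∈ N, h x ∈ N)
    {x : E} (hx : x ∈ N) (m : ℕ) : hn m x ∈ N := by
  induction m using Nat.twoStepInduction with
  | zero => rwa [H.zero]
  | one => rw [H.one]; exact hN x hx
  | more k ih₀ ih₁ =>
    have : hn (k + 2) x = h (hn (k + 1) x) - p • hn (k + 1) x - c k • hn k x := by
      rw [H.step]; abel
    rw [this]
    exact N.sub_mem (N.sub_mem (hN _ ih₁) (N.smul_mem _ ih₁)) (N.smul_mem _ ih₀)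

lemma ThreeTerm.apply_apply_mem (H : ThreeTerm p c h hn) {N : Submodule ℂ E} {x : E}
    (hx : ∀ m, hn m x ∈ N) (m : ℕ) : h (hn m x) ∈ N := by
  cases m with
  | zero => rw [H.zero, ← H.one]; exact hx 1
  | succ k =>
    rw [H.step]
    exact N.add_mem (N.add_mem (hx _) (N.smul_mem _ (hx _))) (N.smul_mem _ (hx _))

lemma mapsTo_span_range {ι : Type*} {f : E →ₗ[ℂ] E} {b : ι → E}
    (hf : ∀ i, f (b i) ∈ Submodule.span ℂ (Set.range b)) :
    ∀ x ∈ Submodule.span ℂ (Set.range b), f x ∈ Submodule.span ℂ (Set.range b) := by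
  have : Submodule.span ℂ (Set.range b) ≤ (Submodule.span ℂ (Set.range b)).comap f := by
    rw [Submodule.span_le]
    rintro _ ⟨i, rfl⟩
    exact hf i
  exact this

lemma IsArray.span_eq (B : IsArray p d κ h Rh b) (H : ThreeTerm p c h hn)
    (R : ThreeTerm p c' Rh hnr) :
    Submodule.span ℂ (Set.range fun mn : ℕ × ℕ => b mn.1 mn.2) =
      Submodule.span ℂ (Set.range fun mn : ℕ × ℕ => hn mn.1 (hnr mn.2 (b 0 0))) := by
  apply le_antisymm
  · set N := Submodule.span ℂ (Set.range fun mn : ℕ × ℕ => hn mn.1 (hnr mn.2 (b 0 0)))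
    have hmem : ∀ m n, hn m (hnr n (b 0 0)) ∈ N := fun m n => Submodule.subset_span ⟨(m, n), rfl⟩
    have hN : ∀ x ∈ N, h x ∈ N :=
      mapsTo_span_range fun mn => H.apply_apply_mem (fun m => hmem m mn.2) mn.1
    set N₀ := Submodule.span ℂ (Set.range fun n : ℕ => hnr n (b 0 0)) with hN₀def
    have hmem₀ : ∀ n, hnr n (b 0 0) ∈ N₀ := fun n => Submodule.subset_span ⟨n, rfl⟩
    have hN₀ : ∀ x ∈ N₀, Rh x ∈ N₀ := mapsTo_span_range fun n => R.apply_apply_mem hmem₀ n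
    have hle : N₀ ≤ N := by
      rw [hN₀def, Submodule.span_le]
      rintro _ ⟨n, rfl⟩
      have := hmem 0 n
      rwa [H.zero] at this
    have hb₀ : ∀ n, b 0 n ∈ N₀ := fun n => by
      have h₀ : b 0 0 ∈ N₀ := by
        have : hnr 0 (b 0 0) ∈ N₀ := Submodule.subset_span ⟨0, rfl⟩
        rwa [R.zero] at this
      induction n using Nat.twoStepInduction with
      | zero => exact h₀
      | one =>
        have : b 0 1 = Rh (b 0 0) - p • b 0 0 := by rw [B.right_zero]; abel
        rw [this]
        exact N₀.sub_mem (hN₀ _ h₀) (N₀.smul_mem _ h₀)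
      | more k ih₀ ih₁ =>
        have : b 0 (k + 2) = Rh (b 0 (k + 1)) - p • b 0 (k + 1) - d • b 0 k := by
          rw [B.right_succ]; abel
        rw [this]
        exact N₀.sub_mem (N₀.sub_mem (hN₀ _ ih₁) (N₀.smul_mem _ ih₁)) (N₀.smul_mem _ ih₀)
    have hb : ∀ m n, b m n ∈ N := fun m n => by
      induction m using Nat.twoStepInduction with
      | zero => exact hle (hb₀ n)
      | one =>
        cases n with
        | zero =>
          have : b 1 0 = h (b 0 0) - p • b 0 0 := by rw [B.left_zero_zero]; abel
          rw [this]
          exact N.sub_mem (hN _ (hle (hb₀ _))) (N.smul_mem _ (hle (hb₀ _)))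
        | succ n =>
          have : b 1 (n + 1) = h (b 0 (n + 1)) - p • b 0 (n + 1) + κ • b 0 n := by
            rw [B.left_zero_succ]; abel
          rw [this]
          exact N.add_mem (N.sub_mem (hN _ (hle (hb₀ _))) (N.smul_mem _ (hle (hb₀ _))))
            (N.smul_mem _ (hle (hb₀ _)))
      | more k ih₀ ih₁ =>
        have : b (k + 2) n = h (b (k + 1) n) - p • b (k + 1) n - d • b k n := by
          rw [B.left_succ]; abel
        rw [this]
        exact N.sub_mem (N.sub_mem (hN _ ih₁) (N.smul_mem _ ih₁)) (N.smul_mem _ ih₀)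
    rw [Submodule.span_le]
    rintro _ ⟨mn, rfl⟩
    exact hb mn.1 mn.2
  · set N := Submodule.span ℂ (Set.range fun mn : ℕ × ℕ => b mn.1 mn.2)
    have hmem : ∀ m n, b m n ∈ N := fun m n => Submodule.subset_span ⟨(m, n), rfl⟩
    have hN : ∀ x ∈ N, h x ∈ N := by
      refine mapsTo_span_range ?_
      rintro ⟨_ | m, _ | n⟩
      · rw [B.left_zero_zero]
        exact N.add_mem (hmem _ _) (N.smul_mem _ (hmem _ _))
      · rw [B.left_zero_succ]
        exact N.sub_mem (N.add_mem (hmem _ _) (N.smul_mem _ (hmem _ _))) (N.smul_mem _ (hmem _ _))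
      all_goals
        rw [B.left_succ]
        exact N.add_mem (N.add_mem (hmem _ _) (N.smul_mem _ (hmem _ _))) (N.smul_mem _ (hmem _ _))
    set N₀ := Submodule.span ℂ (Set.range fun n : ℕ => b 0 n) with hN₀def
    have hmem₀ : ∀ n, b 0 n ∈ N₀ := fun n => Submodule.subset_span ⟨n, rfl⟩
    have hle : N₀ ≤ N := by
      rw [hN₀def, Submodule.span_le]
      rintro _ ⟨n, rfl⟩
      exact hmem 0 n
    have hN₀ : ∀ x ∈ N₀, Rh x ∈ N₀ := by
      refine mapsTo_span_range ?_
      rintro (_ | n)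
      · rw [B.right_zero]
        exact N₀.add_mem (hmem₀ _) (N₀.smul_mem _ (hmem₀ _))
      · rw [B.right_succ]
        exact N₀.add_mem (N₀.add_mem (hmem₀ _) (N₀.smul_mem _ (hmem₀ _))) (N₀.smul_mem _ (hmem₀ _))
    rw [Submodule.span_le]
    rintro _ ⟨mn, rfl⟩
    exact H.apply_mem hN (hle (R.apply_mem hN₀ (hmem₀ 0) mn.2)) mn.1

variable {E' : Type*} [AddCommGroup E'] [Module ℂ E']

lemma ThreeTerm.prodMap {h' : E' →ₗ[ℂ] E'} {hn' : ℕ → E' →ₗ[ℂ] E'} (H : ThreeTerm p c h hn)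
    (H' : ThreeTerm p c h' hn') :
    ThreeTerm p c (h.prodMap h') fun n => (hn n).prodMap (hn' n) where
  zero x := by simp [H.zero, H'.zero]
  one x := by simp [H.one, H'.one]
  step k x := by simp [H.step, H'.step]

/-- If `b` has defect `1` and `g` has defect `0`, then pairing `b m n` with
`g m n + g (m - 1) (n - 1)` gives an array with defect `1`. -/
lemma IsArray.prod {h' Rh' : E' →ₗ[ℂ] E'} {g : ℕ → ℕ → E'} (B : IsArray p d 1 h Rh b)
    (G : IsArray p d 0 h' Rh' g) :
    IsArray p d 1 (h.prodMap h') (Rh.prodMap Rh') fun m n =>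
      (b m n, g m n + if m = 0 ∨ n = 0 then 0 else g (m - 1) (n - 1)) where
  left_zero_zero := by simp [B.left_zero_zero, G.left_zero_zero]
  left_zero_succ n := by
    simp only [LinearMap.prodMap_apply, B.left_zero_succ, true_or, if_true, add_zero,
      G.left_zero_succ]
    ext <;> simp
    abel
  left_succ m n := by
    rcases n with _ | n <;> rcases m with _ | m <;> simp [B.left_succ, G.left_succ]
    · cases n with
      | zero => rw [G.left_zero_zero]; module
      | succ n => rw [G.left_zero_succ]; module
    · module
  right_zero := by simp [B.right_zero, G.right_zero]
  right_succ n := by simp [B.right_succ, G.right_succ]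

end LinearAlgebra

/-! ### Sums over spheres -/

section Spheres

variable {L : ℕ} {a : Fin L → W L → W L}

lemma finite_sphere (L n : ℕ) : {w : W L | len w = n}.Finite := by
  refine ((List.finite_length_eq (Fin L) n).image (cs L).wordProd).subset fun w hw => ?_
  exact ⟨normalForm w, (length_normalForm w).trans hw, wordProd_normalForm w⟩

/-- The sphere of radius `n` in `W L`. -/
def sphere (L n : ℕ) : Finset (W L) := (finite_sphere L n).toFinset

lemma mem_sphere {n : ℕ} {w : W L} : w ∈ sphere L n ↔ len w = n := by
  simp [sphere]

lemma sphere_zero : sphere L 0 = {1} := by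
  ext w
  simp [mem_sphere, len_eq_zero]

lemma tsum_sphere {M : Type*} [AddCommMonoid M] [TopologicalSpace M] [T2Space M] (F : W L → M)
    (n : ℕ) : ∑' w : {w : W L // len w = n}, F w = ∑ w ∈ sphere L n, F w := by
  rw [← Finset.tsum_subtype]
  exact (Equiv.subtypeEquivRight fun w => (mem_sphere (n := n) (w := w)).symm).tsum_eq
    fun w : {w // w ∈ sphere L n} => F w

variable {E : Type*} [AddCommGroup E]

lemma IsStep.sum_sphere_swap (ha : IsStep a) (F : W L → E) (n m : ℕ) :
    ∑ w ∈ sphere L n, ∑ s, (if len (a s w) = m then F (a s w) else 0) =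
      ∑ v ∈ sphere L m, ∑ s, if len (a s v) = n then F v else 0 := by
  rw [Finset.sum_comm, Finset.sum_comm (s := sphere L m)]
  refine Finset.sum_congr rfl fun s _ => ?_
  rw [← Finset.sum_filter, ← Finset.sum_filter]
  refine Finset.sum_nbij' (a s) (a s) ?_ ?_ ?_ ?_ ?_
  · intro w hw
    simp only [Finset.mem_filter, mem_sphere, ha.invol] at hw ⊢
    exact hw.symm
  · intro w hw
    simp only [Finset.mem_filter, mem_sphere, ha.invol] at hw ⊢
    exact hw.symm
  · exact fun w _ => ha.invol s w
  · exact fun w _ => ha.invol s w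
  · exact fun w _ => rfl

lemma IsStep.sum_descent (ha : IsStep a) {v : W L} (hv : v ≠ 1) (z : E) :
    ∑ s, (if len (a s v) < len v then z else 0) = z := by
  obtain ⟨r, hr⟩ := ha.descent v hv
  simp [hr]

lemma IsStep.sum_sphere_succ (ha : IsStep a) (F : W L → E) (n : ℕ) :
    ∑ w ∈ sphere L n, ∑ s, (if len (a s w) = n + 1 then F (a s w) else 0) =
      ∑ v ∈ sphere L (n + 1), F v := by
  rw [ha.sum_sphere_swap]
  refine Finset.sum_congr rfl fun v hv => ?_
  rw [mem_sphere] at hv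
  have hv1 : v ≠ 1 := by
    rintro rfl
    simp [len_eq_zero.mpr (rfl : (1 : W L) = 1)] at hv
  refine Eq.trans (Finset.sum_congr rfl fun s _ => ?_) (ha.sum_descent hv1 (F v))
  have := ha.len_step s v
  exact if_congr (by omega) rfl rfl

lemma IsStep.sum_sphere_pred [Module ℂ E] (ha : IsStep a) (F : W L → E) (n : ℕ) :
    ∑ w ∈ sphere L (n + 1), ∑ s, (if len (a s w) = n then F (a s w) else 0) =
      (if n = 0 then (L : ℂ) else L - 1) • ∑ v ∈ sphere L n, F v := by
  rw [ha.sum_sphere_swap, Finset.smul_sum]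
  refine Finset.sum_congr rfl fun v hv => ?_
  rw [mem_sphere] at hv
  by_cases hn : n = 0
  · have : ∀ s, len (a s v) = n + 1 := fun s => by
      have := ha.len_step s v
      omega
    simp [this, hn, ← Nat.cast_smul_eq_nsmul ℂ]
  · have hv1 : v ≠ 1 := fun h => hn (by rw [← hv, h, len_eq_zero])
    rw [if_neg hn, sub_smul, one_smul, eq_sub_iff_add_eq]
    nth_rw 2 [← ha.sum_descent hv1 (F v)]
    rw [← Finset.sum_add_distrib]
    have : ∀ s, ((if len (a s v) = n + 1 then F v else 0) +
        if len (a s v) < len v then F v else 0) = F v := fun s => by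
      have := ha.len_step s v
      split_ifs <;> first | omega | simp
    simp [this, ← Nat.cast_smul_eq_nsmul ℂ]

end Spheres

/-! ### Hecke operators on `ℓ²(W)` -/

section Hecke

variable {L : ℕ} {a : Fin L → W L → W L} {p : ℂ} {T : Fin L → H L →L[ℂ] H L}

lemma coe_add_apply (x y : H L) (v : W L) : (x + y) v = x v + y v := rfl

lemma coe_smul_apply (c : ℂ) (x : H L) (v : W L) : (c • x) v = c * x v := rfl

open Classical in
lemma δ_apply (w v : W L) : δ w v = if v = w then 1 else 0 := by
  rw [δ, lp.single_apply, Pi.single_apply]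

/-- Evaluation at a point, as a continuous linear functional. -/
def evalAt (v : W L) : H L →L[ℂ] ℂ := lp.evalCLM ℂ (fun _ : W L => ℂ) 2 v

lemma evalAt_apply (v : W L) (x : H L) : evalAt v x = x v := rfl

lemma clm_ext {φ ψ : H L →L[ℂ] ℂ} (hφ : ∀ w, φ (δ w) = ψ (δ w)) : φ = ψ := by
  classical
  refine lp.ext_continuousLinearMap ENNReal.ofNat_ne_top fun w => ?_
  ext
  have := hφ w
  simp only [δ] at this
  simpa only [ContinuousLinearMap.comp_apply, lp.singleContinuousLinearMap_apply] using this

lemma IsStep.hecke_apply (ha : IsStep a)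
    (hT : ∀ s w, T s (δ w) = if len (a s w) < len w then δ (a s w) + p • δ w else δ (a s w))
    (s : Fin L) (x : H L) (v : W L) :
    T s x v = x (a s v) + (if len (a s v) < len v then p else 0) * x v := by
  have : (evalAt v).comp (T s) =
      evalAt (a s v) + (if len (a s v) < len v then p else 0) • evalAt v := by
    refine clm_ext fun w => ?_
    classical
    have hiff : v = a s w ↔ a s v = w :=
      ⟨fun h => by rw [h, ha.invol], fun h => by rw [← h, ha.invol]⟩
    simp only [ContinuousLinearMap.comp_apply, add_apply,
      smul_apply, smul_eq_mul, evalAt_apply, hT]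
    by_cases hvw : v = w
    · subst hvw
      split_ifs <;> simp only [coe_add_apply, coe_smul_apply, δ_apply, hiff]
      all_goals simp
    · split_ifs <;> simp only [coe_add_apply, coe_smul_apply, δ_apply, hiff] <;> simp [*]
  exact DFunLike.congr_fun this x

lemma IsStep.hecke_hecke (ha : IsStep a)
    (hT : ∀ s w, T s (δ w) = if len (a s w) < len w then δ (a s w) + p • δ w else δ (a s w))
    (s : Fin L) (x : H L) : T s (T s x) = x + p • T s x := by
  ext v
  simp only [coe_add_apply, coe_smul_apply,
    ha.hecke_apply hT, ha.invol]
  have := ha.len_step s v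
  split_ifs <;> first | omega | ring

lemma IsStep.threeTerm (ha : IsStep a)
    (hT : ∀ s w, T s (δ w) = if len (a s w) < len w then δ (a s w) + p • δ w else δ (a s w))
    {h : H L →L[ℂ] H L} (hh : h = ∑ s, T s) {Tw : W L → H L →L[ℂ] H L} (hTw1 : Tw 1 = 1)
    (hTwrec : ∀ s w, len (a s w) < len w → Tw w = T s ∘L Tw (a s w))
    {hn : ℕ → H L →L[ℂ] H L} (hhn : ∀ n, hn n = ∑' w : {w : W L // len w = n}, Tw w) :
    ThreeTerm p (fun k => if k = 0 then (L : ℂ) else L - 1) (h : H L →ₗ[ℂ] H L)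
      (fun n => (hn n : H L →ₗ[ℂ] H L)) := by
  have hone : len (1 : W L) = 0 := len_eq_zero.mpr rfl
  have hsum : ∀ n x, hn n x = ∑ w ∈ sphere L n, Tw w x := fun n x => by
    rw [hhn, tsum_sphere, sum_apply]
  have hzero : ∀ x, hn 0 x = x := fun x => by
    simp [hsum, sphere_zero, hTw1]
  have hTTw : ∀ s w x, T s (Tw w x) =
      Tw (a s w) x + if len (a s w) < len w then p • Tw w x else 0 := fun s w x => by
    split_ifs with hs
    · rw [hTwrec s w hs]
      exact ha.hecke_hecke hT s _
    · have := ha.len_step s w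
      rw [hTwrec s (a s w) (by rw [ha.invol]; omega), ha.invol, add_zero]
      rfl
  refine ⟨hzero, fun x => ?_, fun k x => ?_⟩
  · change hn 1 x = h x
    have hlen : ∀ s, len (a s 1) = 1 := fun s => by
      have := ha.len_step s 1
      omega
    rw [hsum, ← ha.sum_sphere_succ (fun w => Tw w x), sphere_zero, Finset.sum_singleton, hh,
      sum_apply]
    refine Finset.sum_congr rfl fun s _ => ?_
    have := hTTw s 1 x
    rw [if_neg (by omega), add_zero, hTw1] at this
    rw [hlen, if_pos rfl, ← this]
    rfl
  · change h (hn (k + 1) x) = hn (k + 2) x + p • hn (k + 1) x + _ • hn k x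
    have hsucc := ha.sum_sphere_succ (fun w => Tw w x) (k + 1)
    have hpred := ha.sum_sphere_pred (fun w => Tw w x) k
    rw [hsum (k + 1), hsum (k + 2), hsum k, ← hsucc, ← hpred, Finset.smul_sum, ← Finset.sum_add_distrib,
      ← Finset.sum_add_distrib, map_sum]
    refine Finset.sum_congr rfl fun w hw => ?_
    rw [mem_sphere] at hw
    have hw1 : w ≠ 1 := by
      rintro rfl
      omega
    rw [← ha.sum_descent hw1 (p • Tw w x), ← Finset.sum_add_distrib, ← Finset.sum_add_distrib, hh,
      sum_apply]
    refine Finset.sum_congr rfl fun s _ => ?_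
    rw [hTTw]
    have := ha.len_step s w
    split_ifs <;> first | omega | simp [add_comm]

lemma IsStep.sum_hecke_apply (ha : IsStep a)
    (hT : ∀ s w, T s (δ w) = if len (a s w) < len w then δ (a s w) + p • δ w else δ (a s w))
    {h : H L →L[ℂ] H L} (hh : h = ∑ s, T s) (x : H L) (v : W L) :
    h x v = up a x v + down a x v + (∑ s, if len (a s v) < len v then p else 0) * x v := by
  rw [hh, sum_apply, lp.coeFn_sum, Finset.sum_apply, up_apply, down_apply,
    Finset.sum_mul, ← Finset.sum_add_distrib, ← Finset.sum_add_distrib]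
  refine Finset.sum_congr rfl fun s _ => ?_
  rw [ha.hecke_apply hT]
  have := ha.len_step s v
  split_ifs <;> first | omega | simp

lemma IsStep.coe_sum_hecke (ha : IsStep a)
    (hT : ∀ s w, T s (δ w) = if len (a s w) < len w then δ (a s w) + p • δ w else δ (a s w))
    {h : H L →L[ℂ] H L} (hh : h = ∑ s, T s) {x : H L} (hx : x 1 = 0) :
    (h x : W L → ℂ) = up a x + down a x + p • (x : W L → ℂ) := by
  funext v
  rw [ha.sum_hecke_apply hT hh]
  by_cases hv : v = 1
  · simp [hv, hx]
  · rw [ha.sum_descent hv]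
    rfl

lemma IsStep.leading_term (ha : IsStep a)
    (hT : ∀ s w, T s (δ w) = if len (a s w) < len w then δ (a s w) + p • δ w else δ (a s w))
    {h : H L →L[ℂ] H L} (hh : h = ∑ s, T s) {x : H L} {k : ℕ} (hx : AtMost k x) :
    AtMost (k + 1) (h x) ∧ sphereRestrict (k + 1) (h x) = up a (sphereRestrict k x) := by
  have hdown : ∀ v, k < len v → down a x v = 0 := fun v hv => by
    rw [down_apply]
    refine Finset.sum_eq_zero fun s _ => ?_
    split_ifs with hs
    · exact hx _ (by omega)
    · rfl
  constructor
  · intro v hv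
    rw [ha.sum_hecke_apply hT hh, hdown v (by omega), hx v (by omega), up_apply]
    simp only [mul_zero, add_zero]
    refine Finset.sum_eq_zero fun s _ => ?_
    split_ifs with hs
    · exact hx _ (by have := ha.len_step s v; omega)
    · rfl
  · funext v
    simp only [sphereRestrict, up_apply]
    split_ifs with hv
    · rw [ha.sum_hecke_apply hT hh, hdown v (by omega), hx v (by omega), up_apply]
      simp only [mul_zero, add_zero]
      refine Finset.sum_congr rfl fun s _ => ?_
      have := ha.len_step s v
      split_ifs <;> first | omega | rfl
    · refine (Finset.sum_eq_zero fun s _ => ?_).symm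
      have := ha.len_step s v
      split_ifs <;> first | omega | rfl

lemma IsStep.leading_term_pow (ha : IsStep a)
    (hT : ∀ s w, T s (δ w) = if len (a s w) < len w then δ (a s w) + p • δ w else δ (a s w))
    {h : H L →L[ℂ] H L} (hh : h = ∑ s, T s) {c : ℕ → ℂ} {hn : ℕ → H L →L[ℂ] H L}
    (H₃ : ThreeTerm p c (h : H L →ₗ[ℂ] H L) (fun n => (hn n : H L →ₗ[ℂ] H L)))
    {x : H L} {k : ℕ} (hx : AtMost k x) (m : ℕ) :
    AtMost (m + k) (hn m x) ∧
      sphereRestrict (m + k) (hn m x) = (up a ^ m) (sphereRestrict k x) := by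
  have h₀ : hn 0 x = x := H₃.zero x
  have h₁ : hn 1 x = h x := H₃.one x
  have hstep : ∀ n v, hn (n + 2) x v = h (hn (n + 1) x) v - p * hn (n + 1) x v - c n * hn n x v :=
    fun n v => by
      have : h (hn (n + 1) x) = hn (n + 2) x + p • hn (n + 1) x + c n • hn n x := H₃.step n x
      rw [this]
      simp only [coe_add_apply, coe_smul_apply]
      ring
  induction m using Nat.twoStepInduction with
  | zero => simpa [h₀] using hx
  | one => simpa [h₁, add_comm 1 k] using ha.leading_term hT hh hx
  | more n ih₀ ih₁ =>
    have hlead := ha.leading_term hT hh ih₁.1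
    have heq : ∀ v, n + 1 + k < len v → hn (n + 2) x v = h (hn (n + 1) x) v := fun v hv => by
      rw [hstep, ih₁.1 v hv, ih₀.1 v (by omega)]
      simp
    constructor
    · intro v hv
      rw [heq v (by omega), hlead.1 v (by omega)]
    · rw [pow_succ', Module.End.mul_apply, ← ih₁.2, ← hlead.2]
      funext v
      simp only [sphereRestrict]
      by_cases hv : len v = n + 2 + k
      · rw [if_pos hv, if_pos (by omega), heq v (by omega)]
      · rw [if_neg hv, if_neg (by omega)]

lemma coe_proj {Q : ℕ → H L →L[ℂ] H L} (hQ : ∀ l w, Q l (δ w) = if len w = l then δ w else 0)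
    (l : ℕ) (x : H L) : (Q l x : W L → ℂ) = sphereRestrict l x := by
  funext v
  have : (evalAt v).comp (Q l) = (if len v = l then (1 : ℂ) else 0) • evalAt v := by
    refine clm_ext fun w => ?_
    classical
    simp only [ContinuousLinearMap.comp_apply, smul_apply, smul_eq_mul,
      evalAt_apply, hQ]
    by_cases hvw : v = w
    · subst hvw
      split_ifs <;> simp [δ_apply]
    · split_ifs <;> simp [δ_apply, hvw]
  have := DFunLike.congr_fun this x
  simp only [ContinuousLinearMap.comp_apply, smul_apply, smul_eq_mul,
    evalAt_apply] at this
  rw [this, sphereRestrict]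
  split_ifs <;> simp

lemma atLevel_of_mem_V {l : ℕ} {x : H L} (hx : x ∈ V L l) : AtLevel l x := by
  intro v hv
  have : V L l ≤ LinearMap.ker (evalAt v : H L →ₗ[ℂ] ℂ) := by
    rw [V, Submodule.span_le]
    rintro _ ⟨w, hw, rfl⟩
    classical
    have : v ≠ w := fun h => hv (h ▸ hw)
    simp [evalAt_apply, δ_apply, this]
  exact this hx

lemma inner_δ (x : H L) (w : W L) : ⟪x, δ w⟫ = starRingEnd ℂ (x w) := by
  classical
  simp [δ, lp.inner_single_right]

lemma IsStep.down_eq_zero (ha : IsStep a)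
    (hT : ∀ s w, T s (δ w) = if len (a s w) < len w then δ (a s w) + p • δ w else δ (a s w))
    {h : H L →L[ℂ] H L} (hh : h = ∑ s, T s) {Q : ℕ → H L →L[ℂ] H L}
    (hQ : ∀ l w, Q l (δ w) = if len w = l then δ w else 0) {l : ℕ} (hl : l ≠ 0) {x : H L}
    (hx : AtLevel l x) (hperp : ∀ y ∈ V L (l - 1), ⟪x, Q l (h y)⟫ = 0) : down a x = 0 := by
  funext v
  by_cases hv : len v = l - 1
  · have := hperp (δ v) (Submodule.subset_span ⟨v, hv, rfl⟩)
    rw [hh, sum_apply, map_sum, inner_sum] at this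
    rw [down_apply, Pi.zero_apply, ← map_eq_zero (starRingEnd ℂ), map_sum]
    refine (Finset.sum_congr rfl fun s _ => ?_).trans this
    have := ha.len_step s v
    rw [hT]
    split_ifs
    · omega
    · rw [hQ, if_pos (by omega), inner_δ]
    · rw [map_add, map_smul, hQ, hQ, if_neg (by omega), if_neg (by omega)]
      simp
    · omega
  · rw [down_apply]
    refine Finset.sum_eq_zero fun s _ => ?_
    have := ha.len_step s v
    split_ifs
    · exact hx _ (by omega)
    · rfl

section Array

variable {Tr : Fin L → H L →L[ℂ] H L} {h Rh : H L →L[ℂ] H L} {hn hnr Q : ℕ → H L →L[ℂ] H L}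
  {c c' : ℕ → ℂ} {l : ℕ} {ξ : H L}

lemma coe_array
    (hT : ∀ s w, T s (δ w) = if len (σ s * w) < len w then δ (σ s * w) + p • δ w else δ (σ s * w))
    (hh : h = ∑ s, T s)
    (hTr : ∀ s w, Tr s (δ w) = if len (w * σ s) < len w then δ (w * σ s) + p • δ w else δ (w * σ s))
    (hRh : Rh = ∑ s, Tr s)
    (H₃ : ThreeTerm p c (h : H L →ₗ[ℂ] H L) (fun n => (hn n : H L →ₗ[ℂ] H L)))
    (R₃ : ThreeTerm p c' (Rh : H L →ₗ[ℂ] H L) (fun n => (hnr n : H L →ₗ[ℂ] H L)))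
    (hQ : ∀ l w, Q l (δ w) = if len w = l then δ w else 0) (hξ : AtLevel l ξ) (m n : ℕ) :
    (Q (m + n + l) (hn m (hnr n ξ)) : W L → ℂ) =
      (up (fun s w => σ s * w) ^ m) ((up (fun s w => w * σ s) ^ n) ξ) := by
  have hr := (isStep_right L).leading_term_pow hTr hRh R₃ hξ.atMost n
  have hl := (isStep_left L).leading_term_pow hT hh H₃ hr.1 m
  rw [coe_proj hQ, add_assoc, hl.2, hr.2, hξ.sphereRestrict_eq]

lemma isArray_proj
    (hT : ∀ s w, T s (δ w) = if len (σ s * w) < len w then δ (σ s * w) + p • δ w else δ (σ s * w))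
    (hh : h = ∑ s, T s)
    (hTr : ∀ s w, Tr s (δ w) = if len (w * σ s) < len w then δ (w * σ s) + p • δ w else δ (w * σ s))
    (hRh : Rh = ∑ s, Tr s)
    (H₃ : ThreeTerm p c (h : H L →ₗ[ℂ] H L) (fun n => (hn n : H L →ₗ[ℂ] H L)))
    (R₃ : ThreeTerm p c' (Rh : H L →ₗ[ℂ] H L) (fun n => (hnr n : H L →ₗ[ℂ] H L)))
    (hQ : ∀ l w, Q l (δ w) = if len w = l then δ w else 0) (hl : l ≠ 0) (hξ : AtLevel l ξ)
    (hdl : down (fun s w => σ s * w) ξ = 0) (hdr : down (fun s w => w * σ s) ξ = 0) {κ : ℂ}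
    (hκ : ∀ n, down (fun s w => σ s * w) ((up (fun s w => w * σ s) ^ (n + 1)) ξ) =
      -κ • (up (fun s w => w * σ s) ^ n) ξ) :
    IsArray p (L - 1) κ (h : H L →ₗ[ℂ] H L) (Rh : H L →ₗ[ℂ] H L)
      fun m n => Q (m + n + l) (hn m (hnr n ξ)) := by
  have hb := coe_array hT hh hTr hRh H₃ R₃ hQ hξ
  set b : ℕ → ℕ → H L := fun m n => Q (m + n + l) (hn m (hnr n ξ)) with hbdef
  replace hb : ∀ m n, (b m n : W L → ℂ) =
    (up (fun s w => σ s * w) ^ m) ((up (fun s w => w * σ s) ^ n) ξ) := hb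
  have hone : ∀ m n, b m n 1 = 0 := fun m n => by
    have := (isStep_left L).atLevel_up_pow ((isStep_right L).atLevel_up_pow hξ n) m
    rw [← hb] at this
    exact this.apply_one (by omega)
  have hleft : ∀ m n, (h (b m n) : W L → ℂ) =
      b (m + 1) n + down (fun s w => σ s * w) (b m n) + p • (b m n : W L → ℂ) := fun m n => by
    rw [(isStep_left L).coe_sum_hecke hT hh (hone m n), hb (m + 1), pow_succ', Module.End.mul_apply,
      ← hb]
  have hright : ∀ n, (Rh (b 0 n) : W L → ℂ) =
      b 0 (n + 1) + down (fun s w => w * σ s) (b 0 n) + p • (b 0 n : W L → ℂ) := fun n => by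
    rw [(isStep_right L).coe_sum_hecke hTr hRh (hone 0 n), hb 0 (n + 1), pow_succ' _ n, pow_zero,
      Module.End.one_apply, Module.End.mul_apply, hb 0 n, pow_zero, Module.End.one_apply]
  refine ⟨?_, fun n => ?_, fun m n => ?_, ?_, fun n => ?_⟩
  · refine lp.ext ((hleft 0 0).trans ?_)
    have : down (fun s w => σ s * w) (b 0 0) = 0 := by simpa [hb] using hdl
    rw [this, add_zero]
    rfl
  · refine lp.ext ((hleft 0 (n + 1)).trans ?_)
    have : down (fun s w => σ s * w) (b 0 (n + 1)) = -κ • (b 0 n : W L → ℂ) := by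
      simpa [hb] using hκ n
    rw [this]
    funext v
    change b 1 (n + 1) v + -κ * b 0 n v + p * b 0 (n + 1) v =
      b 1 (n + 1) v + p * b 0 (n + 1) v - κ * b 0 n v
    ring
  · refine lp.ext ((hleft (m + 1) n).trans ?_)
    have : down (fun s w => σ s * w) (b (m + 1) n) = ((L : ℂ) - 1) • (b m n : W L → ℂ) := by
      rw [hb (m + 1), pow_succ', Module.End.mul_apply, ← hb]
      exact (isStep_left L).down_up (hone m n)
    rw [this]
    exact add_right_comm _ _ _
  · refine lp.ext ((hright 0).trans ?_)
    have : down (fun s w => w * σ s) (b 0 0) = 0 := by simpa [hb] using hdr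
    rw [this, add_zero]
    rfl
  · refine lp.ext ((hright (n + 1)).trans ?_)
    have : down (fun s w => w * σ s) (b 0 (n + 1)) = ((L : ℂ) - 1) • (b 0 n : W L → ℂ) := by
      have h₀ := (isStep_right L).down_up (hone 0 n)
      rw [hb 0 n, pow_zero, Module.End.one_apply] at h₀
      rw [hb 0 (n + 1), hb 0 n, pow_succ' _ n, pow_zero, Module.End.one_apply, Module.End.one_apply,
        Module.End.mul_apply, h₀]
    rw [this]
    exact add_right_comm _ _ _

end Array

end Hecke

theorem statement16
    (L : ℕ) (hL : 3 ≤ L) (q p : ℝ) (hq : 0 < q) (hq1 : q ≤ 1)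
    (hp : p = (q - 1) / Real.sqrt q)
    (T : Fin L → H L →L[ℂ] H L)
    (hT : ∀ (s : Fin L) (w : W L),
      T s (δ w) =
        if len (σ s * w) < len w then δ (σ s * w) + (p : ℂ) • δ w else δ (σ s * w))
    (h : H L →L[ℂ] H L) (hh : h = ∑ s, T s)
    (Tw : W L → H L →L[ℂ] H L) (hTw1 : Tw 1 = 1)
    (hTwrec : ∀ (s : Fin L) (w : W L), len (σ s * w) < len w →
      Tw w = T s ∘L Tw (σ s * w))
    (hn : ℕ → H L →L[ℂ] H L)
    (hhn : ∀ n : ℕ, hn n = ∑' w : {w : W L // len w = n}, Tw (w : W L))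
    (Tr : Fin L → H L →L[ℂ] H L)
    (hTr : ∀ (s : Fin L) (w : W L),
      Tr s (δ w) =
        if len (w * σ s) < len w then δ (w * σ s) + (p : ℂ) • δ w else δ (w * σ s))
    (Rh : H L →L[ℂ] H L) (hRh : Rh = ∑ s, Tr s)
    (Twr : W L → H L →L[ℂ] H L) (hTwr1 : Twr 1 = 1)
    (hTwrrec : ∀ (s : Fin L) (w : W L), len (w * σ s) < len w →
      Twr w = Tr s ∘L Twr (w * σ s))
    (hnr : ℕ → H L →L[ℂ] H L)
    (hhnr : ∀ n : ℕ, hnr n = ∑' w : {w : W L // len w = n}, Twr (w : W L))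
    (Q : ℕ → H L →L[ℂ] H L)
    (hQ : ∀ (l : ℕ) (w : W L), Q l (δ w) = if len w = l then δ w else 0)
    (l : ℕ) (hl : 2 ≤ l)
    (β : H L) (hβ0 : β ≠ 0)
    (hβmem : β ∈ V L 1)
    (hβperp : ∀ y ∈ Sl L Q h Rh 1, ⟪β, y⟫ = 0)
    (γ : H L) (hγ0 : γ ≠ 0)
    (hγmem : γ ∈ V L l)
    (hγperp : ∀ y ∈ Sl L Q h Rh l, ⟪γ, y⟫ = 0)
    (Xb Xg : Submodule ℂ (H L))
    (hXb : Xb = (Submodule.span ℂ (Set.range fun mn : ℕ × ℕ =>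
      Q (mn.1 + mn.2 + 1) (hn mn.1 (hnr mn.2 β)))).topologicalClosure)
    (hXg : Xg = (Submodule.span ℂ (Set.range fun mn : ℕ × ℕ =>
      Q (mn.1 + mn.2 + l) (hn mn.1 (hnr mn.2 γ)))).topologicalClosure) :
    Xb = (Submodule.span ℂ (Set.range fun mn : ℕ × ℕ =>
        hn mn.1 (hnr mn.2 β))).topologicalClosure ∧
    Xg = (Submodule.span ℂ (Set.range fun mn : ℕ × ℕ =>
        hn mn.1 (hnr mn.2 γ))).topologicalClosure ∧
    ∀ T : Xb ≃L[ℂ] Xg,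
      (∀ (m n : ℕ) (hmem : Q (m + n + 1) (hn m (hnr n β)) ∈ Xb),
        (T ⟨Q (m + n + 1) (hn m (hnr n β)), hmem⟩ : H L) =
          Q (m + n + l) (hn m (hnr n γ)) +
            (if m = 0 ∨ n = 0 then 0
              else Q (m - 1 + (n - 1) + l) (hn (m - 1) (hnr (n - 1) γ)))) →
      ∀ m n : ℕ, ∃ hmem2 : hn m (hnr n β) ∈ Xb,
        (T ⟨hn m (hnr n β), hmem2⟩ : H L) = hn m (hnr n γ) := by
  have H₃ := (isStep_left L).threeTerm hT hh hTw1 hTwrec hhn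
  have R₃ := (isStep_right L).threeTerm hTr hRh hTwr1 hTwrrec hhnr
  have hβ := atLevel_of_mem_V hβmem
  have hγ := atLevel_of_mem_V hγmem
  have hβl : down (fun s w => σ s * w) β = 0 :=
    (isStep_left L).down_eq_zero hT hh hQ one_ne_zero hβ fun y hy =>
      hβperp _ (Submodule.subset_span (Or.inl ⟨y, hy, rfl⟩))
  have hβr : down (fun s w => w * σ s) β = 0 :=
    (isStep_right L).down_eq_zero hTr hRh hQ one_ne_zero hβ fun y hy =>
      hβperp _ (Submodule.subset_span (Or.inr ⟨y, hy, rfl⟩))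
  have hγl : down (fun s w => σ s * w) γ = 0 :=
    (isStep_left L).down_eq_zero hT hh hQ (by omega) hγ fun y hy =>
      hγperp _ (Submodule.subset_span (Or.inl ⟨y, hy, rfl⟩))
  have hγr : down (fun s w => w * σ s) γ = 0 :=
    (isStep_right L).down_eq_zero hTr hRh hQ (by omega) hγ fun y hy =>
      hγperp _ (Submodule.subset_span (Or.inr ⟨y, hy, rfl⟩))
  have B := isArray_proj hT hh hTr hRh H₃ R₃ hQ one_ne_zero hβ hβl hβr (κ := 1) fun n => by
    rw [pow_succ, Module.End.mul_apply,
      down_left_up_right_pow le_rfl ((isStep_right L).atLevel_up hβ),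
      down_left_up_right_of_one hβ hβl, map_neg, neg_one_smul]
  have G := isArray_proj hT hh hTr hRh H₃ R₃ hQ (by omega) hγ hγl hγr (κ := 0) fun n => by
    rw [down_left_up_right_pow hl hγ, hγl, map_zero, neg_zero, zero_smul]
  have hβ₀ : Q (0 + 0 + 1) (hn 0 (hnr 0 β)) = β :=
    lp.ext (coe_array hT hh hTr hRh H₃ R₃ hQ hβ 0 0)
  have hγ₀ : Q (0 + 0 + l) (hn 0 (hnr 0 γ)) = γ :=
    lp.ext (coe_array hT hh hTr hRh H₃ R₃ hQ hγ 0 0)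
  have hspanβ := B.span_eq H₃ R₃
  have hspanγ := G.span_eq H₃ R₃
  simp only [hβ₀, hγ₀, ContinuousLinearMap.coe_coe] at hspanβ hspanγ
  refine ⟨by rw [hXb, hspanβ], by rw [hXg, hspanγ], fun T hTβ m n => ?_⟩
  have hspan := (B.prod G).span_eq (H₃.prodMap H₃) (R₃.prodMap R₃)
  set Γ : Submodule ℂ (H L × H L) :=
    LinearMap.range (Xb.subtype.prod (Xg.subtype ∘ₗ (T : Xb →ₗ[ℂ] Xg)))
  have hΓ : Submodule.span ℂ (Set.range fun mn : ℕ × ℕ =>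
      (Q (mn.1 + mn.2 + 1) (hn mn.1 (hnr mn.2 β)), Q (mn.1 + mn.2 + l) (hn mn.1 (hnr mn.2 γ)) +
        if mn.1 = 0 ∨ mn.2 = 0 then 0
        else Q (mn.1 - 1 + (mn.2 - 1) + l) (hn (mn.1 - 1) (hnr (mn.2 - 1) γ)))) ≤ Γ := by
    rw [Submodule.span_le]
    rintro _ ⟨mn, rfl⟩
    have hmem : Q (mn.1 + mn.2 + 1) (hn mn.1 (hnr mn.2 β)) ∈ Xb := by
      rw [hXb]
      exact Submodule.le_topologicalClosure _ (Submodule.subset_span ⟨mn, rfl⟩)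
    exact ⟨⟨_, hmem⟩, Prod.ext rfl (hTβ mn.1 mn.2 hmem)⟩
  have hmem : (hn m (hnr n β), hn m (hnr n γ)) ∈ Γ := by
    refine hΓ (hspan ▸ Submodule.subset_span ⟨(m, n), ?_⟩)
    simp only [hβ₀, hγ₀]
    simp
  obtain ⟨x, hx⟩ := hmem
  have hx₁ : (x : H L) = hn m (hnr n β) := congrArg Prod.fst hx
  have hx₂ : (T x : H L) = hn m (hnr n γ) := congrArg Prod.snd hx
  refine ⟨hx₁ ▸ x.2, ?_⟩
  rw [← hx₂]
  exact congrArg (fun z : Xb => (T z : H L)) (Subtype.ext hx₁.symm)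

end UCoxMasa
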